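/- For every integer h ≥ 2 and every real δ > 0 there exist a real number β > 1/(h(δ+1) + 2), a constant c > 0, and a threshold N₁ such that for all N ≥ N₁, the number of positive integers n < N with s_F(n^h) > δ·s_F(n) is at least c·N^β. -/

import Mathlib

/-- Zeckendorf sum of digits: number of summands in the Zeckendorf
representation of `n` (equivalently, minimal number of Fibonacci numbers
needed to write `n` as a sum of Fibonacci numbers). -/
def sF (n : ℕ) : ℕ := (Nat.zeckendorf n).length

/-- Lucas numbers: `L 0 = 2`, `L k = F (k-1) + F (k+1)` for `k ≥ 1`. -/
def lucas : ℕ → ℕ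
  | 0 => 2
  | k + 1 => Nat.fib k + Nat.fib (k + 2)

lemma List.IsZeckendorfRep.two_le {l : List ℕ} (hl : l.IsZeckendorfRep) : ∀ a ∈ l, 2 ≤ a := by
  induction l with
  | nil => simp
  | cons b l ih =>
    cases l with
    | nil => simpa [List.IsZeckendorfRep] using hl
    | cons c l =>
      simp only [List.IsZeckendorfRep, List.cons_append, List.isChain_cons_cons] at hl ih
      have h2 := ih hl.2
      intro a ha
      rcases List.mem_cons.1 ha with rfl | ha
      · have := h2 c (by simp)
        omega
      · exact h2 a ha

open Real in
open scoped goldenRatio in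
/-- The sum of the conjugates `ψ ^ d` over a Zeckendorf representation with digits at most `D`. -/
lemma List.IsZeckendorfRep.sum_goldenConj_bounds :
    ∀ {l : List ℕ} {D : ℕ}, l.IsZeckendorfRep → 1 ≤ D → (∀ a ∈ l.head?, a ≤ D) →
      -ψ ^ 2 + (-ψ) ^ (D + 1) ≤ (l.map (ψ ^ ·)).sum ∧
        (l.map (ψ ^ ·)).sum ≤ -ψ - (-ψ) ^ (D + 1)
  | [], D, _, hD, _ => by
    have h0 : 0 ≤ -ψ := by linarith [goldenConj_neg]
    have h1 : -ψ ≤ 1 := by linarith [neg_one_lt_goldenConj]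
    have h2 : (-ψ) ^ (D + 1) ≤ (-ψ) ^ 2 := pow_le_pow_of_le_one h0 h1 (by omega)
    have h3 : (-ψ) ^ 2 ≤ -ψ := by nlinarith
    rw [neg_sq] at h2 h3
    simp only [List.map_nil, List.sum_nil]
    constructor <;> linarith
  | a :: l, D, hl, hD, ha => by
    have h0 : 0 < -ψ := by linarith [goldenConj_neg]
    have h1 : -ψ ≤ 1 := by linarith [neg_one_lt_goldenConj]
    have haD : a ≤ D := ha a (by simp)
    have hm : (-ψ) ^ (D + 1) ≤ (-ψ) ^ (a + 1) := pow_le_pow_of_le_one h0.le h1 (by omega)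
    have hsq := goldenConj_sq
    have htwo := hl.two_le
    have ha2 := htwo a (by simp)
    have hl' : l.IsZeckendorfRep := List.IsChain.tail hl
    have hhead : ∀ b ∈ l.head?, b ≤ a - 2 := by
      intro b hb
      obtain ⟨l', rfl⟩ := List.head?_eq_some_iff.1 hb
      simp only [List.IsZeckendorfRep, List.cons_append, List.isChain_cons_cons] at hl
      omega
    rw [List.map_cons, List.sum_cons]
    rcases ha2.eq_or_lt with rfl | ha3
    · have hnil : l = [] := by
        rcases l with _ | ⟨b, l⟩
        · rfl
        · have := htwo b (by simp)
          have := hhead b (by simp)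
          omega
      subst hnil
      have hcube : (-ψ) ^ (2 + 1) = -ψ - ψ ^ 2 := by linear_combination -ψ * hsq
      have hpos := sq_nonneg ψ
      rw [List.map_nil, List.sum_nil]
      constructor <;> nlinarith
    · obtain ⟨h2, h3⟩ := hl'.sum_goldenConj_bounds (D := a - 2) (by omega) hhead
      obtain ⟨e, rfl⟩ : ∃ e, a = e + 2 := ⟨a - 2, by omega⟩
      rw [Nat.add_sub_cancel] at h2 h3
      have hstep : (-ψ) ^ (e + 1) = (-ψ) ^ (e + 2) + (-ψ) ^ (e + 2 + 1) := by
        linear_combination (-ψ) ^ (e + 1) * -hsq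
      have habs : |ψ ^ (e + 2)| = (-ψ) ^ (e + 2) := by rw [abs_pow, abs_of_neg goldenConj_neg]
      obtain ⟨h4, h5⟩ := abs_le.1 habs.le
      constructor <;> linarith

open Real in
open scoped goldenRatio in
lemma sum_zeckendorf_goldenConj_bounds (n : ℕ) :
    -ψ ^ 2 < ((Nat.zeckendorf n).map (ψ ^ ·)).sum ∧
      ((Nat.zeckendorf n).map (ψ ^ ·)).sum < -ψ := by
  have h0 : 0 < -ψ := by linarith [goldenConj_neg]
  have := (Nat.isZeckendorfRep_zeckendorf n).sum_goldenConj_bounds (D := Nat.greatestFib n + 1)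
    (by omega) (by
      intro a ha
      rcases Nat.eq_zero_or_pos n with rfl | hn
      · simp at ha
      · rw [Nat.zeckendorf_of_pos hn] at ha
        simp at ha
        omega)
  have hp : 0 < (-ψ) ^ (Nat.greatestFib n + 1 + 1) := by positivity
  constructor <;> linarith

lemma List.IsZeckendorfRep.map_add {l : List ℕ} (hl : l.IsZeckendorfRep) (j : ℕ) :
    (l.map (· + j)).IsZeckendorfRep := by
  induction l with
  | nil => simp
  | cons b l ih =>
    cases l with
    | nil =>
      simp [List.IsZeckendorfRep] at hl ⊢
      omega
    | cons c l =>
      simp only [List.IsZeckendorfRep, List.cons_append, List.isChain_cons_cons,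
        List.map_cons] at hl ih ⊢
      exact ⟨by omega, ih hl.2⟩

open Real in
open scoped goldenRatio in
lemma sum_map_fib_pred_add {l : List ℕ} (hl : ∀ a ∈ l, 2 ≤ a) :
    ((l.map fun d => Nat.fib (d - 1)).sum : ℕ) + ψ * ((l.map Nat.fib).sum : ℕ) =
      (l.map (ψ ^ ·)).sum := by
  induction l with
  | nil => simp
  | cons b l ih =>
    have hb := hl b (by simp)
    obtain ⟨e, rfl⟩ : ∃ e, b = e + 1 := ⟨b - 1, by omega⟩
    have := goldenConj_mul_fib_succ_add_fib e
    simp only [List.map_cons, List.sum_cons, ← ih fun a ha => hl a (by simp [ha]), ← this]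
    push_cast
    ring

lemma sum_map_fib_add {l : List ℕ} (hl : ∀ a ∈ l, 2 ≤ a) (j : ℕ) :
    ((l.map (· + j)).map Nat.fib).sum =
      (l.map fun d => Nat.fib (d - 1)).sum * Nat.fib j + (l.map Nat.fib).sum * Nat.fib (j + 1) := by
  induction l with
  | nil => simp
  | cons b l ih =>
    have hb := hl b (by simp)
    obtain ⟨e, rfl⟩ : ∃ e, b = e + 1 := ⟨b - 1, by omega⟩
    have := Nat.fib_add e j
    simp only [List.map_cons, List.sum_cons, ih fun a ha => hl a (by simp [ha]),
      Nat.add_sub_cancel]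
    rw [show e + 1 + j = e + j + 1 by ring, this]
    ring

open Real in
open scoped goldenRatio in
/-- If `x` is close to `y / φ` then `x F_j + y F_{j+1}` is the shift of `y` by `j` digits. -/
lemma zeckendorf_mul_fib_add {x y : ℕ} (hxy : |(x : ℝ) + ψ * y| < ψ ^ 2) (j : ℕ) :
    Nat.zeckendorf (x * Nat.fib j + y * Nat.fib (j + 1)) =
      (Nat.zeckendorf y).map (· + j) := by
  have hrep := Nat.isZeckendorfRep_zeckendorf y
  have h1 := sum_map_fib_pred_add hrep.two_le
  have h2 := sum_map_fib_add hrep.two_le j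
  obtain ⟨h3, h4⟩ := sum_zeckendorf_goldenConj_bounds y
  rw [Nat.sum_zeckendorf_fib] at h1 h2
  obtain ⟨h5, h6⟩ := abs_lt.1 hxy
  have hx : x = ((Nat.zeckendorf y).map fun d => Nat.fib (d - 1)).sum := by
    have hsq := goldenConj_sq
    have hlt : (x : ℝ) < (((Nat.zeckendorf y).map fun d => Nat.fib (d - 1)).sum : ℕ) + 1 := by
      have hψ : ψ < -1 / 2 := by nlinarith [goldenConj_neg]
      linarith
    have hgt : (((Nat.zeckendorf y).map fun d => Nat.fib (d - 1)).sum : ℕ) < (x : ℝ) + 1 := by linarith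
    norm_cast at hlt hgt
    omega
  rw [hx, ← h2, Nat.zeckendorf_sum_fib (hrep.map_add j)]

lemma sF_fib_add {d r : ℕ} (hd : 2 ≤ d) (hr : r < Nat.fib (d - 1)) :
    sF (Nat.fib d + r) = sF r + 1 := by
  have hg : Nat.greatestFib (Nat.fib d + r) = d := by
    apply le_antisymm
    · rw [← Nat.lt_succ_iff, Nat.greatestFib_lt, Nat.succ_eq_add_one,
        Nat.fib_add_one (by omega)]
      omega
    · rw [Nat.le_greatestFib]
      omega
  have hpos : 0 < Nat.fib d := Nat.fib_pos.2 (by omega)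
  simp [sF, Nat.zeckendorf_of_pos (show 0 < Nat.fib d + r by omega), hg]

lemma exists_eq_fib_add {n : ℕ} (hn : 0 < n) :
    ∃ d r, 2 ≤ d ∧ r < Nat.fib (d - 1) ∧ n = Nat.fib d + r ∧
      Nat.zeckendorf n = d :: Nat.zeckendorf r := by
  have h1 := Nat.fib_greatestFib_le n
  have h2 := Nat.lt_fib_greatestFib_add_one n
  have h3 : 2 ≤ Nat.greatestFib n := Nat.le_greatestFib.2 hn
  rw [Nat.fib_add_one (by omega)] at h2
  exact ⟨Nat.greatestFib n, n - Nat.fib (Nat.greatestFib n), h3, by omega, by omega,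
    Nat.zeckendorf_of_pos hn⟩

lemma sF_le_of_lt_fib {n r : ℕ} (hn : n < Nat.fib (2 * r + 2)) : sF n ≤ r := by
  induction r generalizing n with
  | zero => simp_all [sF]
  | succ r ih =>
    rcases Nat.eq_zero_or_pos n with rfl | hpos
    · simp [sF]
    obtain ⟨d, s, hd, hs, rfl, -⟩ := exists_eq_fib_add hpos
    rw [sF_fib_add hd hs]
    have hd' : d < 2 * (r + 1) + 2 := by
      by_contra! hc
      have := Nat.fib_mono hc
      omega
    have := Nat.fib_mono (show d - 1 ≤ 2 * r + 2 by omega)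
    have := ih (n := s) (by omega)
    omega

lemma le_sF_fib_sub {q r b : ℕ} (hb : 0 < b) (hbq : b ≤ Nat.fib q) :
    r ≤ sF (Nat.fib (q + 2 * r) - b) := by
  induction r with
  | zero => simp
  | succ r ih =>
    have hq : 0 < q := Nat.fib_pos.1 (by omega)
    have hmono := Nat.fib_mono (show q ≤ q + 2 * r by omega)
    have hrec := Nat.fib_add_two (n := q + 2 * r)
    rw [show Nat.fib (q + 2 * (r + 1)) - b
      = Nat.fib (q + 2 * r + 1) + (Nat.fib (q + 2 * r) - b) by
        rw [show q + 2 * (r + 1) = q + 2 * r + 2 by ring]; omega,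
      sF_fib_add (by omega) (by rw [Nat.add_sub_cancel]; omega)]
    omega

/-- Subtracting a small number from a number with many trailing zero digits creates many digits. -/
lemma le_sF_sub {A q r b : ℕ} (hA : 0 < A) (hb : 0 < b) (hbq : b ≤ Nat.fib q)
    (hdig : ∀ a ∈ Nat.zeckendorf A, q + 2 * r ≤ a) : r ≤ sF (A - b) := by
  induction A using Nat.strong_induction_on with
  | _ A ih =>
    obtain ⟨d, s, hd, hs, rfl, hz⟩ := exists_eq_fib_add hA
    rw [hz] at hdig
    have hqd := hdig d (by simp)
    rcases Nat.eq_zero_or_pos s with rfl | hspos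
    · have := le_sF_fib_sub (q := d - 2 * r) (r := r) hb
        (hbq.trans (Nat.fib_mono (by omega)))
      rwa [show d - 2 * r + 2 * r = d by omega] at this
    · have hdig' : ∀ a ∈ Nat.zeckendorf s, q + 2 * r ≤ a := fun a ha => hdig a (by simp [ha])
      have hbs : b ≤ s := by
        obtain ⟨e, t, he, ht, hst, hz'⟩ := exists_eq_fib_add hspos
        have := Nat.fib_mono ((show q ≤ q + 2 * r by omega).trans (hdig' e (by simp [hz'])))
        omega
      have hdpos : 0 < Nat.fib d := Nat.fib_pos.2 (by omega)
      have := ih s (by omega) hspos hdig'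
      rw [Nat.add_sub_assoc hbs, sF_fib_add hd (by omega)]
      omega

lemma lucas_add_two (k : ℕ) : lucas (k + 2) = lucas k + lucas (k + 1) := by
  cases k with
  | zero => rfl
  | succ k =>
    simp only [lucas]
    rw [Nat.fib_add_two (n := k + 2), Nat.fib_add_two (n := k)]
    ring

lemma lucas_add (s j : ℕ) :
    lucas (s + 1 + j) = lucas s * Nat.fib j + lucas (s + 1) * Nat.fib (j + 1) := by
  induction j using Nat.twoStepInduction with
  | zero => simp
  | one => simp [lucas_add_two]
  | more j h1 h2 =>
    rw [show s + 1 + (j + 2) = s + 1 + j + 2 by ring, lucas_add_two, h1,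
      show s + 1 + j + 1 = s + 1 + (j + 1) by ring, h2, Nat.fib_add_two (n := j),
      Nat.fib_add_two (n := j + 1), Nat.fib_add_two (n := j)]
    ring

open Real in
open scoped goldenRatio in
lemma coe_lucas (k : ℕ) : (lucas k : ℝ) = φ ^ k + ψ ^ k := by
  induction k using Nat.twoStepInduction with
  | zero => norm_num [lucas]
  | one => norm_num [lucas, goldenRatio_add_goldenConj]
  | more k h1 h2 =>
    rw [lucas_add_two]
    push_cast
    rw [h1, h2, pow_add φ k 2, pow_add ψ k 2, goldenRatio_sq, goldenConj_sq]
    ring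

open Real in
open scoped goldenRatio in
lemma zeckendorf_mul_lucas {M p : ℕ} (hM : (M : ℝ) ≤ φ ^ p) (j : ℕ) :
    Nat.zeckendorf (M * lucas (p + 4 + j)) =
      (Nat.zeckendorf (M * lucas (p + 4))).map (· + j) := by
  rw [lucas_add (p + 3) j, mul_add, ← mul_assoc, ← mul_assoc]
  apply zeckendorf_mul_fib_add
  have hprod := goldenRatio_mul_goldenConj
  have hφ := goldenRatio_pos
  push_cast
  rw [coe_lucas, coe_lucas, show (M : ℝ) * (φ ^ (p + 3) + ψ ^ (p + 3)) +
      ψ * (M * (φ ^ (p + 3 + 1) + ψ ^ (p + 3 + 1))) =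
      M * ψ ^ p * (ψ ^ 3 * (1 + ψ ^ 2)) by
    rw [pow_succ φ (p + 3)]
    linear_combination M * φ ^ (p + 3) * hprod]
  have hle : |(M : ℝ) * ψ ^ p| ≤ 1 := by
    rw [abs_mul, abs_pow, Nat.abs_cast]
    calc (M : ℝ) * |ψ| ^ p ≤ φ ^ p * |ψ| ^ p := by gcongr
      _ = |φ * ψ| ^ p := by rw [abs_mul, abs_of_pos hφ, mul_pow]
      _ = 1 := by rw [hprod]; simp
  have hlt : |ψ ^ 3 * (1 + ψ ^ 2)| < ψ ^ 2 := by
    have h1 := goldenConj_neg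
    have hsq := goldenConj_sq
    have h5 : 0 < 1 + ψ := by linarith [neg_one_lt_goldenConj]
    rw [abs_mul, abs_of_pos (show 0 < 1 + ψ ^ 2 by positivity), abs_pow, abs_of_neg h1]
    have h6 : 0 < ψ ^ 2 := sq_pos_of_neg h1
    have : -ψ * (1 + ψ ^ 2) < 1 := by nlinarith
    calc (-ψ) ^ 3 * (1 + ψ ^ 2) = ψ ^ 2 * (-ψ * (1 + ψ ^ 2)) := by ring
      _ < ψ ^ 2 * 1 := by gcongr
      _ = ψ ^ 2 := mul_one _
  rw [abs_mul]
  calc _ ≤ 1 * |ψ ^ 3 * (1 + ψ ^ 2)| := by gcongr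
    _ < ψ ^ 2 := by rwa [one_mul]

open Real in
open scoped goldenRatio in
lemma goldenRatio_pow_le_fib (n : ℕ) : φ ^ n ≤ Nat.fib (n + 2) := by
  induction n using Nat.twoStepInduction with
  | zero => simp
  | one => norm_num [Nat.fib_add_two]; exact goldenRatio_lt_two.le
  | more n h1 h2 =>
    rw [Nat.fib_add_two (n := n + 2), pow_add, goldenRatio_sq]
    push_cast
    rw [pow_succ] at h2
    linarith

open Real in
open scoped goldenRatio in
lemma coe_lucas_le_of_odd {k : ℕ} (hk : Odd k) : (lucas k : ℝ) ≤ φ ^ k := by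
  rw [coe_lucas]
  linarith [hk.pow_neg goldenConj_neg]

lemma lucas_pos (k : ℕ) : 0 < lucas k := by
  cases k <;> simp [lucas]

open Real in
open scoped goldenRatio in
lemma lucas_mul_lucas_of_odd {k : ℕ} (hk : Odd k) (g : ℕ) :
    lucas ((g + 2) * k) = lucas k * lucas ((g + 1) * k) + lucas (g * k) := by
  have h1 : φ ^ k * ψ ^ k = -1 := by
    rw [← mul_pow, goldenRatio_mul_goldenConj, hk.neg_one_pow]
  have : (lucas ((g + 2) * k) : ℝ) = lucas k * lucas ((g + 1) * k) + lucas (g * k) := by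
    simp only [coe_lucas, mul_comm _ k, pow_mul]
    linear_combination -((φ ^ k) ^ g + (ψ ^ k) ^ g) * h1
  exact_mod_cast this

open Real in
open scoped goldenRatio in
/-- For odd `k`, the power `L_k ^ h` lies slightly below `L_{hk}`. -/
lemma exists_lucas_pow_add_eq {k : ℕ} (hk : Odd k) (g : ℕ) :
    ∃ B : ℕ, 0 < B ∧ lucas k ^ (g + 2) + B = lucas ((g + 2) * k) ∧
      (B : ℝ) ≤ 2 ^ (g + 2) * φ ^ (g * k) := by
  induction g with
  | zero =>
    refine ⟨2, by norm_num, ?_, by norm_num⟩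
    rw [lucas_mul_lucas_of_odd hk]
    simp [lucas, sq]
  | succ g ih =>
    obtain ⟨B, hB, heq, hle⟩ := ih
    refine ⟨lucas k * B + lucas ((g + 1) * k), ?_, ?_, ?_⟩
    · have := lucas_pos ((g + 1) * k)
      omega
    · rw [lucas_mul_lucas_of_odd hk (g + 1), show g + 1 + 1 = g + 2 by ring, ← heq]
      ring
    · have h1 := coe_lucas_le_of_odd hk
      have hφ := one_lt_goldenRatio
      have h2 : (lucas ((g + 1) * k) : ℝ) ≤ 2 * φ ^ ((g + 1) * k) := by
        rw [coe_lucas]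
        have : ψ ^ ((g + 1) * k) ≤ φ ^ ((g + 1) * k) := by
          refine (le_abs_self _).trans ?_
          rw [abs_pow]
          gcongr
          rw [abs_of_neg goldenConj_neg]
          linarith [neg_one_lt_goldenConj]
        linarith
      have h4 : (2 : ℝ) ≤ 2 ^ (g + 2) := by
        rw [pow_succ]
        linarith [one_le_pow₀ (one_le_two (α := ℝ)) (n := g + 1)]
      push_cast
      calc (lucas k : ℝ) * B + lucas ((g + 1) * k)
          ≤ φ ^ k * (2 ^ (g + 2) * φ ^ (g * k)) + 2 ^ (g + 2) * φ ^ ((g + 1) * k) := by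
            gcongr
            exact h2.trans (by gcongr)
        _ = 2 ^ (g + 1 + 2) * φ ^ ((g + 1) * k) := by ring

open Real in
open scoped goldenRatio in
lemma sF_mul_lucas_le {m p k : ℕ} (hm : (m : ℝ) ≤ φ ^ p) (hk : p + 4 ≤ k) :
    sF (m * lucas k) ≤ p + 3 := by
  obtain ⟨j, rfl⟩ := Nat.exists_eq_add_of_le hk
  have h1 : sF (m * lucas (p + 4 + j)) = sF (m * lucas (p + 4)) := by
    simp [sF, zeckendorf_mul_lucas hm]
  rw [h1]
  apply sF_le_of_lt_fib
  have h2 := goldenRatio_pow_le_fib (2 * p + 6)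
  have hφ := one_lt_goldenRatio
  have h3 : (lucas (p + 4) : ℝ) < φ ^ (p + 6) := by
    rw [coe_lucas]
    have h5 : ψ ^ (p + 4) ≤ 1 := by
      refine (le_abs_self _).trans ?_
      rw [abs_pow]
      refine pow_le_one₀ (abs_nonneg _) ?_
      rw [abs_of_neg goldenConj_neg]
      linarith [neg_one_lt_goldenConj]
    have h6 : (1 : ℝ) ≤ φ ^ (p + 4) := one_le_pow₀ hφ.le
    rw [show φ ^ (p + 6) = φ ^ (p + 4) * φ ^ 2 by ring, goldenRatio_sq]
    nlinarith
  have h4 : ((m * lucas (p + 4) : ℕ) : ℝ) < Nat.fib (2 * (p + 3) + 2) := by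
    push_cast
    calc (m : ℝ) * lucas (p + 4) ≤ φ ^ p * lucas (p + 4) := by gcongr
      _ < φ ^ p * φ ^ (p + 6) := by gcongr
      _ = φ ^ (2 * p + 6) := by ring
      _ ≤ _ := h2
  exact_mod_cast h4

open Real in
open scoped goldenRatio in
lemma le_sF_mul_lucas_pow {g m p k r : ℕ} (hm : 0 < m) (hmp : (m : ℝ) ≤ φ ^ p) (hk : Odd k)
    (hr : k = (g + 2) * p + (g + 2) + 2 + r) : r ≤ sF ((m * lucas k) ^ (g + 2)) := by
  obtain ⟨B, hB, heq, hBle⟩ := exists_lucas_pow_add_eq hk g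
  have hpow : (m * lucas k) ^ (g + 2) =
      m ^ (g + 2) * lucas ((g + 2) * k) - m ^ (g + 2) * B := by
    rw [← heq, mul_add, Nat.add_sub_cancel, mul_pow]
  have hM : ((m ^ (g + 2) : ℕ) : ℝ) ≤ φ ^ ((g + 2) * p) := by
    push_cast
    rw [mul_comm (g + 2) p, pow_mul]
    gcongr
  have hMpos : 0 < m ^ (g + 2) := by positivity
  have hφ := one_lt_goldenRatio
  rw [hpow]
  refine le_sF_sub (q := (g + 2) * p + 2 * (g + 2) + g * k + 2)
    (Nat.mul_pos hMpos (lucas_pos _)) (Nat.mul_pos hMpos hB) ?_ ?_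
  · have h2 : (2 : ℝ) ^ (g + 2) ≤ φ ^ (2 * (g + 2)) := by
      rw [pow_mul]
      gcongr
      rw [goldenRatio_sq]
      linarith
    have : ((m ^ (g + 2) * B : ℕ) : ℝ) ≤ Nat.fib ((g + 2) * p + 2 * (g + 2) + g * k + 2) := by
      rw [Nat.cast_mul]
      calc ((m ^ (g + 2) : ℕ) : ℝ) * B
          ≤ φ ^ ((g + 2) * p) * (φ ^ (2 * (g + 2)) * φ ^ (g * k)) := by
            gcongr
            exact hBle.trans (by gcongr)
        _ = φ ^ ((g + 2) * p + 2 * (g + 2) + g * k) := by ring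
        _ ≤ _ := goldenRatio_pow_le_fib _
    exact_mod_cast this
  · obtain ⟨j, hj⟩ : ∃ j, (g + 2) * k = (g + 2) * p + 4 + j := by
      refine Nat.exists_eq_add_of_le ?_
      nlinarith
    rw [hj, zeckendorf_mul_lucas hM]
    simp only [List.mem_map, forall_exists_index, and_imp, forall_apply_eq_imp_iff₂]
    intro a ha
    have := (Nat.isZeckendorfRep_zeckendorf _).two_le a ha
    have h1 : (g + 2) * k = g * k + 2 * k := by ring
    omega

open Real in
open scoped goldenRatio in
/-- The members of the set below `N` coming from the multiples `m L_k` with `m ≤ φ ^ p`. -/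
lemma goldenRatio_pow_le_ncard {h p N : ℕ} (hh : 2 ≤ h) {δ : ℝ} (hδ : 0 < δ)
    (hN : φ ^ ((h + δ + 1) * p + (h + 5 + 3 * δ)) ≤ N) :
    φ ^ p / 2 ≤
      (Set.ncard {n : ℕ | 0 < n ∧ n < N ∧ (sF (n ^ h) : ℝ) > δ * sF n} : ℝ) := by
  obtain ⟨g, rfl⟩ : ∃ g, h = g + 2 := ⟨h - 2, by omega⟩
  have hφ := one_lt_goldenRatio
  obtain ⟨r, hr1, hr2, hodd⟩ : ∃ r : ℕ, δ * (p + 3) < r ∧ (r : ℝ) ≤ δ * (p + 3) + 2 ∧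
      Odd ((g + 2) * p + (g + 2) + 2 + r) := by
    have h1 := Nat.lt_floor_add_one (δ * (p + 3))
    have h2 := Nat.floor_le (show 0 ≤ δ * (p + 3) by positivity)
    set f := ⌊δ * (p + 3)⌋₊
    rcases Nat.even_or_odd ((g + 2) * p + (g + 2) + 2 + (f + 1)) with he | ho
    · exact ⟨f + 2, by push_cast; linarith, by push_cast; linarith, he.add_one⟩
    · exact ⟨f + 1, by push_cast; linarith, by push_cast; linarith, ho⟩
  obtain ⟨k, hk⟩ : ∃ k, k = (g + 2) * p + (g + 2) + 2 + r := ⟨_, rfl⟩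
  rw [← hk] at hodd
  have hrpos : 0 < r := by
    have : (0 : ℝ) < r := lt_of_le_of_lt (by positivity) hr1
    exact_mod_cast this
  have hLN : φ ^ p * φ ^ k < N := by
    refine lt_of_lt_of_le ?_ hN
    rw [← pow_add, ← rpow_natCast]
    refine rpow_lt_rpow_of_exponent_lt hφ ?_
    rw [hk]
    push_cast
    nlinarith
  have hsub : (fun m => m * lucas k) '' (Finset.Icc 1 ⌊φ ^ p⌋₊ : Finset ℕ) ⊆
      {n : ℕ | 0 < n ∧ n < N ∧ (sF (n ^ (g + 2)) : ℝ) > δ * sF n} := by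
    rintro _ ⟨m, hm, rfl⟩
    rw [Finset.coe_Icc, Set.mem_Icc] at hm
    have hmp : (m : ℝ) ≤ φ ^ p := (Nat.le_floor_iff (by positivity)).1 hm.2
    refine ⟨Nat.mul_pos hm.1 (lucas_pos k), ?_, ?_⟩
    · have : ((m * lucas k : ℕ) : ℝ) < N := by
        push_cast
        refine lt_of_le_of_lt ?_ hLN
        gcongr
        exact coe_lucas_le_of_odd hodd
      exact_mod_cast this
    · have h1 : ((sF (m * lucas k) : ℕ) : ℝ) ≤ p + 3 := by
        exact_mod_cast sF_mul_lucas_le hmp (by nlinarith)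
      have h2 : (r : ℝ) ≤ sF ((m * lucas k) ^ (g + 2)) := by
        exact_mod_cast le_sF_mul_lucas_pow hm.1 hmp hodd hk
      have h3 : δ * sF (m * lucas k) ≤ δ * (p + 3) := by gcongr
      simp only [gt_iff_lt]
      linarith
  have hfin : {n : ℕ | 0 < n ∧ n < N ∧ (sF (n ^ (g + 2)) : ℝ) > δ * sF n}.Finite :=
    (Set.finite_Iio N).subset fun n hn => hn.2.1
  have hcard := Set.ncard_le_ncard hsub hfin
  rw [Set.ncard_image_of_injective _ fun a b hab => Nat.eq_of_mul_eq_mul_right (lucas_pos k) hab,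
    Set.ncard_coe_finset, Nat.card_Icc, Nat.add_sub_cancel] at hcard
  have hfloor := Nat.lt_floor_add_one (φ ^ p)
  have hone : 1 ≤ ⌊φ ^ p⌋₊ := Nat.le_floor (by simpa using one_le_pow₀ hφ.le)
  have hone' : (1 : ℝ) ≤ ⌊φ ^ p⌋₊ := by exact_mod_cast hone
  calc φ ^ p / 2 ≤ (⌊φ ^ p⌋₊ : ℝ) := by linarith
    _ ≤ _ := by exact_mod_cast hcard

theorem stmt_5 (h : ℕ) (hh : 2 ≤ h) (δ : ℝ) (hδ : 0 < δ) :
    ∃ β : ℝ, β > 1 / (h * (δ + 1) + 2) ∧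
      ∃ c : ℝ, 0 < c ∧ ∃ N₁ : ℕ, ∀ N : ℕ, N₁ ≤ N →
        c * (N : ℝ) ^ β ≤
          (Set.ncard {n : ℕ | 0 < n ∧ n < N ∧ (sF (n ^ h) : ℝ) > δ * sF n} : ℝ) := by
  have hφ := Real.one_lt_goldenRatio
  have hφ0 := Real.goldenRatio_pos
  have hh' : (2 : ℝ) ≤ h := by exact_mod_cast hh
  have hD : (0 : ℝ) < h + δ + 1 := by linarith
  set D : ℝ := h + δ + 1 with hDdef
  set E : ℝ := h + 5 + 3 * δ with hEdef
  refine ⟨1 / D, one_div_lt_one_div_of_lt hD (by nlinarith), Real.goldenRatio ^ (-E / D - 1) / 2,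
    by positivity, ⌈Real.goldenRatio ^ E⌉₊, fun N hN => ?_⟩
  have hNE : Real.goldenRatio ^ E ≤ N := Nat.ceil_le.1 hN
  have hN0 : (0 : ℝ) < N := lt_of_lt_of_le (by positivity) hNE
  obtain ⟨y, hy⟩ : ∃ y : ℝ, Real.goldenRatio ^ y = N :=
    ⟨Real.logb Real.goldenRatio N, Real.rpow_logb hφ0 hφ.ne' hN0⟩
  have hEy : E ≤ y := by
    rw [← hy] at hNE
    exact (Real.rpow_le_rpow_left_iff hφ).1 hNE
  have hp1 := Nat.floor_le (show 0 ≤ (y - E) / D from div_nonneg (by linarith) hD.le)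
  have hp2 := Nat.lt_floor_add_one ((y - E) / D)
  set p := ⌊(y - E) / D⌋₊
  refine le_trans ?_ (goldenRatio_pow_le_ncard (p := p) hh hδ ?_)
  · rw [← hy, ← Real.rpow_mul hφ0.le, div_mul_eq_mul_div, ← Real.rpow_add hφ0,
      ← Real.rpow_natCast]
    gcongr
    · exact hφ.le
    · have : -E / D - 1 + y * (1 / D) = (y - E) / D - 1 := by ring
      linarith
  · rw [← hy]
    refine Real.rpow_le_rpow_of_exponent_le hφ.le ?_
    rw [le_div_iff₀ hD] at hp1
    linarith
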